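/- Let R = [a,b] × [c,d] be a compact rectangle in ℝ² with a < b and c < d. Let P', Q' : ℝ² → ℝ be smooth functions (the components of a 1-form β' = P' dx + Q' dy) and let ω : ℝ² → ℝ be a smooth function (the coefficient of an area 2-form ω dx ∧ dy) such that: (i) ω(z) = (∂Q'/∂x)(z) − (∂P'/∂y)(z) for every z in the topological boundary ∂R of R, and (ii) the integral of ω over R equals the integral of (∂Q'/∂x − ∂P'/∂y) over R. Then there exist smooth functions P, Q : ℝ² → ℝ with P = P' and Q = Q' at every point of ∂R, such that (∂Q/∂x)(z) − (∂P/∂y)(z) = ω(z) for every z ∈ R. (This is the extension step in the proof of Theorem 3: a 1-form with prescribed boundary values whose exterior derivative is a prescribed 2-form, obtained by writing ω − dβ' as dβ'' with β'' vanishing on the boundary.) -/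

import Mathlib

open MeasureTheory

open Set in
/-- An interval integral with fixed endpoints depends smoothly on a parameter. -/
theorem contDiff_nat_parametric_intervalIntegral.{u} {H : Type u} [NormedAddCommGroup H]
    [NormedSpace ℝ H] [ProperSpace H] (a b : ℝ) (n : ℕ) :
    ∀ {E : Type u} [NormedAddCommGroup E] [NormedSpace ℝ E] {F : H × ℝ → E},
      ContDiff ℝ n F → ContDiff ℝ n fun x ↦ ∫ t in a..b, F (x, t) := by
  induction n with
  | zero =>
    intro E _ _ F hF
    simp only [CharP.cast_eq_zero, contDiff_zero] at hF ⊢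
    exact intervalIntegral.continuous_parametric_intervalIntegral_of_continuous'
      (f := fun x t ↦ F (x, t)) hF a b
  | succ n ih =>
    intro E _ _ F hF
    let F' : H × ℝ → H →L[ℝ] E := fun p ↦ (fderiv ℝ F p).comp (ContinuousLinearMap.inl ℝ H ℝ)
    have hF' : ContDiff ℝ n F' :=
      (hF.fderiv_right (by norm_cast)).clm_comp contDiff_const
    have hFcont : Continuous F := hF.continuous
    have hF'cont : Continuous F' := hF'.continuous
    have hderiv (x : H) :
        HasFDerivAt (fun x ↦ ∫ t in a..b, F (x, t)) (∫ t in a..b, F' (x, t)) x := by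
      obtain ⟨C, hC⟩ := ((isCompact_closedBall x 1).prod
        (isCompact_uIcc (a := a) (b := b))).exists_bound_of_continuousOn hF'cont.continuousOn
      refine intervalIntegral.hasFDerivAt_integral_of_dominated_of_fderiv_le
        (F := fun x t ↦ F (x, t)) (F' := fun x t ↦ F' (x, t)) (bound := fun _ ↦ C)
        (Metric.closedBall_mem_nhds x one_pos) (.of_forall fun y ↦ ?_) ?_ ?_
        (.of_forall fun t ht y hy ↦ hC (y, t) ⟨hy, uIoc_subset_uIcc ht⟩)
        (by simp) (.of_forall fun t _ y _ ↦ ?_)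
      · exact Continuous.aestronglyMeasurable (by fun_prop)
      · exact Continuous.intervalIntegrable (by fun_prop) _ _
      · exact Continuous.aestronglyMeasurable (by fun_prop)
      · exact ((hF.differentiable (by simp)) (y, t)).hasFDerivAt.comp y
          (hasFDerivAt_prodMk_left y t)
    push_cast
    rw [contDiff_succ_iff_fderiv]
    refine ⟨fun x ↦ (hderiv x).differentiableAt, by simp, ?_⟩
    rw [show fderiv ℝ (fun x ↦ ∫ t in a..b, F (x, t)) = fun x ↦ ∫ t in a..b, F' (x, t) from
      funext fun x ↦ (hderiv x).fderiv]
    exact ih hF'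

/-- An interval integral with fixed lower endpoint and smoothly varying upper endpoint depends
smoothly on a parameter. -/
theorem ContDiff.parametric_intervalIntegral.{u} {H E : Type u} [NormedAddCommGroup H]
    [NormedSpace ℝ H] [ProperSpace H] [NormedAddCommGroup E] [NormedSpace ℝ E]
    {F : H × ℝ → E} {u : H → ℝ} (hF : ContDiff ℝ (⊤ : ℕ∞) F) (hu : ContDiff ℝ (⊤ : ℕ∞) u)
    (a : ℝ) : ContDiff ℝ (⊤ : ℕ∞) fun x ↦ ∫ t in a..u x, F (x, t) := by
  have h : (fun x ↦ ∫ t in a..u x, F (x, t)) =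
      fun x ↦ (u x - a) • ∫ s in (0 : ℝ)..1, F (x, a + (u x - a) * s) := by
    ext x
    rw [intervalIntegral.smul_integral_comp_add_mul (fun t ↦ F (x, t))]
    simp
  rw [h]
  refine (hu.sub contDiff_const).smul (contDiff_infty.2 fun n ↦ ?_)
  refine contDiff_nat_parametric_intervalIntegral 0 1 n
    (F := fun p : H × ℝ ↦ F (p.1, a + (u p.1 - a) * p.2)) ?_
  exact (hF.comp (by fun_prop)).of_le (mod_cast le_top)

theorem fderiv_apply_one_zero {g : ℝ × ℝ → ℝ} {z : ℝ × ℝ} {g' : ℝ}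
    (hg : DifferentiableAt ℝ g z) (h : HasDerivAt (fun x ↦ g (x, z.2)) g' z.1) :
    fderiv ℝ g z (1, 0) = g' :=
  (hg.hasFDerivAt.comp_hasDerivAt z.1
    ((hasDerivAt_id z.1).prodMk (hasDerivAt_const z.1 z.2))).unique h

theorem fderiv_apply_zero_one {g : ℝ × ℝ → ℝ} {z : ℝ × ℝ} {g' : ℝ}
    (hg : DifferentiableAt ℝ g z) (h : HasDerivAt (fun y ↦ g (z.1, y)) g' z.2) :
    fderiv ℝ g z (0, 1) = g' :=
  (hg.hasFDerivAt.comp_hasDerivAt z.2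
    ((hasDerivAt_const z.2 z.1).prodMk (hasDerivAt_id z.2))).unique h

/-- There is a smooth function vanishing at the endpoints of an interval, with integral one. -/
theorem exists_contDiff_integral_eq_one {c d : ℝ} (hcd : c < d) :
    ∃ φ : ℝ → ℝ, ContDiff ℝ (⊤ : ℕ∞) φ ∧ φ c = 0 ∧ φ d = 0 ∧ ∫ t in c..d, φ t = 1 := by
  have hne : d - c ≠ 0 := (sub_pos.2 hcd).ne'
  refine ⟨fun t ↦ 6 / (d - c) ^ 3 * ((t - c) * (d - t)), by fun_prop, by simp, by simp, ?_⟩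
  have hderiv (t : ℝ) : HasDerivAt
      (fun t ↦ 6 / (d - c) ^ 3 * ((d - c) * (t - c) ^ 2 / 2 - (t - c) ^ 3 / 3))
      (6 / (d - c) ^ 3 * ((t - c) * (d - t))) t := by
    have h := (hasDerivAt_id t).sub_const c
    refine (((((h.pow 2).const_mul (d - c)).div_const 2).sub
      ((h.pow 3).div_const 3)).const_mul (6 / (d - c) ^ 3)).congr_deriv ?_
    simp only [id]
    push_cast
    ring
  rw [intervalIntegral.integral_eq_sub_of_hasDerivAt (fun t _ ↦ hderiv t)
    (Continuous.intervalIntegrable (by fun_prop) _ _)]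
  field_simp
  ring

theorem mem_frontier_Icc_prod_Icc {a b c d : ℝ} (hab : a < b) (hcd : c < d) {z : ℝ × ℝ} :
    z ∈ frontier (Set.Icc a b ×ˢ Set.Icc c d) ↔
      z.1 ∈ Set.Icc a b ∧ (z.2 = c ∨ z.2 = d) ∨ (z.1 = a ∨ z.1 = b) ∧ z.2 ∈ Set.Icc c d := by
  rw [frontier_prod_eq, frontier_Icc hab.le, frontier_Icc hcd.le]
  simp

/-- A smooth function on a rectangle that vanishes on the boundary and has integral zero is the
curl of a smooth pair vanishing on the boundary. -/
theorem exists_curl_eq_of_integral_eq_zero {a b c d : ℝ} (hab : a < b) (hcd : c < d)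
    {f : ℝ × ℝ → ℝ} (hf : ContDiff ℝ (⊤ : ℕ∞) f)
    (h_bdry : ∀ z ∈ frontier (Set.Icc a b ×ˢ Set.Icc c d), f z = 0)
    (h_int : ∫ z in Set.Icc a b ×ˢ Set.Icc c d, f z = 0) :
    ∃ P Q : ℝ × ℝ → ℝ, ContDiff ℝ (⊤ : ℕ∞) P ∧ ContDiff ℝ (⊤ : ℕ∞) Q ∧
      (∀ z ∈ frontier (Set.Icc a b ×ˢ Set.Icc c d), P z = 0) ∧
      (∀ z ∈ frontier (Set.Icc a b ×ˢ Set.Icc c d), Q z = 0) ∧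
      ∀ z, fderiv ℝ Q z (1, 0) - fderiv ℝ P z (0, 1) = f z := by
  obtain ⟨φ, hφ, hφc, hφd, hφ1⟩ := exists_contDiff_integral_eq_one hcd
  have hfcont : Continuous f := hf.continuous
  have hφcont : Continuous φ := hφ.continuous
  let F : ℝ → ℝ := fun x ↦ ∫ t in c..d, f (x, t)
  have hF : ContDiff ℝ (⊤ : ℕ∞) F := hf.parametric_intervalIntegral contDiff_const c
  have hFcont : Continuous F := hF.continuous
  have hFint : ∫ x in a..b, F x = 0 := by
    rw [Measure.volume_eq_prod, setIntegral_prod _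
      (hfcont.continuousOn.integrableOn_compact (isCompact_Icc.prod isCompact_Icc))] at h_int
    simpa only [F, intervalIntegral.integral_of_le hab.le, intervalIntegral.integral_of_le hcd.le,
      ← integral_Icc_eq_integral_Ioc] using h_int
  have hside {x : ℝ} (hx : x = a ∨ x = b) {t : ℝ} (ht : t ∈ Set.Icc c d) : f (x, t) = 0 :=
    h_bdry _ ((mem_frontier_Icc_prod_Icc hab hcd).2 (.inr ⟨hx, ht⟩))
  have hFside {x : ℝ} (hx : x = a ∨ x = b) : F x = 0 := by
    refine (intervalIntegral.integral_congr fun t ht ↦ ?_).trans intervalIntegral.integral_zero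
    exact hside hx (Set.uIcc_of_le hcd.le ▸ ht)
  let P : ℝ × ℝ → ℝ := fun z ↦ -∫ t in c..z.2, (f (z.1, t) - φ t * F z.1)
  let Q : ℝ × ℝ → ℝ := fun z ↦ φ z.2 * ∫ t in a..z.1, F t
  have hP : ContDiff ℝ (⊤ : ℕ∞) P := by
    refine (ContDiff.parametric_intervalIntegral
      (F := fun p : (ℝ × ℝ) × ℝ ↦ f (p.1.1, p.2) - φ p.2 * F p.1.1) ?_ contDiff_snd c).neg
    fun_prop
  have hQ : ContDiff ℝ (⊤ : ℕ∞) Q :=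
    (hφ.comp contDiff_snd).mul (ContDiff.parametric_intervalIntegral
      (F := fun p : (ℝ × ℝ) × ℝ ↦ F p.2) (by fun_prop) contDiff_fst a)
  refine ⟨P, Q, hP, hQ, fun z hz ↦ ?_, fun z hz ↦ ?_, fun z ↦ ?_⟩
  · obtain ⟨-, h | h⟩ | ⟨hx, hy⟩ := (mem_frontier_Icc_prod_Icc hab hcd).1 hz
    · simp [P, h]
    · have h1 : IntervalIntegrable (fun t ↦ f (z.1, t)) volume c d :=
        Continuous.intervalIntegrable (by fun_prop) _ _
      have h2 : IntervalIntegrable (fun t ↦ φ t * F z.1) volume c d :=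
        Continuous.intervalIntegrable (by fun_prop) _ _
      simp only [P, h]
      rw [intervalIntegral.integral_sub h1 h2, intervalIntegral.integral_mul_const, hφ1]
      simp [F]
    · refine neg_eq_zero.2
        ((intervalIntegral.integral_congr fun t ht ↦ ?_).trans intervalIntegral.integral_zero)
      rw [Set.uIcc_of_le hy.1] at ht
      simp [hFside hx, hside hx ⟨ht.1, ht.2.trans hy.2⟩]
  · obtain ⟨-, h | h⟩ | ⟨h | h, -⟩ := (mem_frontier_Icc_prod_Icc hab hcd).1 hz <;>
      simp [Q, h, hφc, hφd, hFint]
  · rw [fderiv_apply_one_zero (hQ.differentiable (by simp) z)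
        ((hFcont.integral_hasStrictDerivAt a z.1).hasDerivAt.const_mul (φ z.2)),
      fderiv_apply_zero_one (hP.differentiable (by simp) z)
        (Continuous.integral_hasStrictDerivAt (f := fun t ↦ f (z.1, t) - φ t * F z.1)
          (by fun_prop) c z.2).hasDerivAt.neg]
    ring

/-- Extension step in the proof of Theorem 3: given a smooth 1-form
`β' = P' dx + Q' dy` and a smooth 2-form coefficient `ω` on the rectangle
`R = [a,b] × [c,d]` such that `ω` agrees with the curl `∂Q'/∂x − ∂P'/∂y` on the
topological boundary of `R` and has the same total integral over `R`, there is a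
smooth 1-form `β = P dx + Q dy` agreeing with `β'` on the boundary of `R` whose
curl equals `ω` on all of `R`. -/
theorem one_form_with_prescribed_boundary_and_curl
    (a b c d : ℝ) (hab : a < b) (hcd : c < d)
    (P' Q' ω : ℝ × ℝ → ℝ)
    (hP' : ContDiff ℝ (⊤ : ℕ∞) P') (hQ' : ContDiff ℝ (⊤ : ℕ∞) Q') (hω : ContDiff ℝ (⊤ : ℕ∞) ω)
    (h_bdry : ∀ z ∈ frontier (Set.Icc a b ×ˢ Set.Icc c d),
      ω z = fderiv ℝ Q' z (1, 0) - fderiv ℝ P' z (0, 1))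
    (h_int : ∫ z in Set.Icc a b ×ˢ Set.Icc c d, ω z =
      ∫ z in Set.Icc a b ×ˢ Set.Icc c d,
        (fderiv ℝ Q' z (1, 0) - fderiv ℝ P' z (0, 1))) :
    ∃ P Q : ℝ × ℝ → ℝ,
      ContDiff ℝ (⊤ : ℕ∞) P ∧ ContDiff ℝ (⊤ : ℕ∞) Q ∧
      (∀ z ∈ frontier (Set.Icc a b ×ˢ Set.Icc c d), P z = P' z) ∧
      (∀ z ∈ frontier (Set.Icc a b ×ˢ Set.Icc c d), Q z = Q' z) ∧
      (∀ z ∈ Set.Icc a b ×ˢ Set.Icc c d,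
        fderiv ℝ Q z (1, 0) - fderiv ℝ P z (0, 1) = ω z) := by
  have hcurl : ContDiff ℝ (⊤ : ℕ∞)
      fun z ↦ fderiv ℝ Q' z (1, 0) - fderiv ℝ P' z (0, 1) :=
    ((hQ'.fderiv_right (m := (⊤ : ℕ∞)) (by simp)).clm_apply contDiff_const).sub
      ((hP'.fderiv_right (m := (⊤ : ℕ∞)) (by simp)).clm_apply contDiff_const)
  have hK : IsCompact (Set.Icc a b ×ˢ Set.Icc c d) := isCompact_Icc.prod isCompact_Icc
  obtain ⟨P, Q, hP, hQ, hP0, hQ0, hPQ⟩ := exists_curl_eq_of_integral_eq_zero hab hcd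
    (hω.sub hcurl) (fun z hz ↦ sub_eq_zero.2 (h_bdry z hz)) (by
      rw [integral_sub (hω.continuous.continuousOn.integrableOn_compact hK)
        (hcurl.continuous.continuousOn.integrableOn_compact hK), h_int, sub_self])
  refine ⟨P' + P, Q' + Q, hP'.add hP, hQ'.add hQ, fun z hz ↦ ?_, fun z hz ↦ ?_, fun z _ ↦ ?_⟩
  · simp [hP0 z hz]
  · simp [hQ0 z hz]
  · rw [fderiv_add (hQ'.differentiable (by simp) z) (hQ.differentiable (by simp) z),
      fderiv_add (hP'.differentiable (by simp) z) (hP.differentiable (by simp) z)]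
    simp only [add_apply]
    linarith [hPQ z]
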